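/- Let (u, v, w) be a smooth solution of the vcmKdV equation and let Ψ₁ : ℝ² → ℂ⁴ be a nowhere-vanishing solution of the Lax pair at ζ = ζ₁, where ζ₁ ≠ ζ₁*. Then for every ζ ≠ ζ₁* the one-fold Darboux matrix satisfies the intertwining identities ∂_x T[1](ζ) + T[1](ζ)U(ζ) = U[1](ζ)T[1](ζ) and ∂_t T[1](ζ) + T[1](ζ)V(ζ) = V[1](ζ)T[1](ζ), where U[1](ζ), V[1](ζ) are the Lax matrices built from the transformed potentials (u[1], v[1], w[1]). -/

import Mathlib

open Matrix Filter Topology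

noncomputable section

/-- Partial derivative in the first (space) variable. -/
def dX (f : ℝ × ℝ → ℂ) : ℝ × ℝ → ℂ := fun p => deriv (fun x => f (x, p.2)) p.1

/-- Partial derivative in the second (time) variable. -/
def dT (f : ℝ × ℝ → ℂ) : ℝ × ℝ → ℂ := fun p => deriv (fun t => f (p.1, t)) p.2

/-- Left-hand side of one component of the vcmKdV equation
`f_t + f_xxx + 3((q†q) f_x + (q†q_x) f)` for `q = (u,v,w)ᵀ`. -/
def vcmLHS (u v w f : ℝ × ℝ → ℂ) (p : ℝ × ℝ) : ℂ :=
  dT f p + dX (dX (dX f)) p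
    + 3 * (((starRingEnd ℂ) (u p) * u p + (starRingEnd ℂ) (v p) * v p
            + (starRingEnd ℂ) (w p) * w p) * dX f p
         + ((starRingEnd ℂ) (u p) * dX u p + (starRingEnd ℂ) (v p) * dX v p
            + (starRingEnd ℂ) (w p) * dX w p) * f p)

/-- The vector complex modified KdV equation
`q_t + q_xxx + 3(q_x q† q + q q† q_x) = 0` for `q = (u,v,w)ᵀ`. -/
def vcmKdVeq (u v w : ℝ × ℝ → ℂ) : Prop :=
  ∀ p : ℝ × ℝ, vcmLHS u v w u p = 0 ∧ vcmLHS u v w v p = 0 ∧ vcmLHS u v w w p = 0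

/-- `J = diag(1, -1, -1, -1)`. -/
def Jmat : Matrix (Fin 4) (Fin 4) ℂ := Matrix.diagonal ![1, -1, -1, -1]

/-- The potential matrix `Q` built from the entries `u, v, w`. -/
def Qmat (u v w : ℂ) : Matrix (Fin 4) (Fin 4) ℂ :=
  !![0, u, v, w;
     -((starRingEnd ℂ) u), 0, 0, 0;
     -((starRingEnd ℂ) v), 0, 0, 0;
     -((starRingEnd ℂ) w), 0, 0, 0]

/-- `U(ζ) = -iζJ + Q`. -/
def Umat (ζ u v w : ℂ) : Matrix (Fin 4) (Fin 4) ℂ :=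
  (-Complex.I * ζ) • Jmat + Qmat u v w

/-- `V(ζ) = -4iζ³J + 4ζ²Q - 2iζ(Q² + Q_x)J + (-Q_xx + 2Q³ + Q_x Q - Q Q_x)`. -/
def Vmat (ζ u v w ux vx wx uxx vxx wxx : ℂ) : Matrix (Fin 4) (Fin 4) ℂ :=
  (-4 * Complex.I * ζ ^ 3) • Jmat + (4 * ζ ^ 2) • Qmat u v w
    - (2 * Complex.I * ζ) • ((Qmat u v w ^ 2 + Qmat ux vx wx) * Jmat)
    + (-Qmat uxx vxx wxx + 2 * Qmat u v w ^ 3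
        + Qmat ux vx wx * Qmat u v w - Qmat u v w * Qmat ux vx wx)

/-- `U(ζ)` as a matrix-valued field on `ℝ²`. -/
def Ufield (u v w : ℝ × ℝ → ℂ) (ζ : ℂ) (p : ℝ × ℝ) : Matrix (Fin 4) (Fin 4) ℂ :=
  Umat ζ (u p) (v p) (w p)

/-- `V(ζ)` as a matrix-valued field on `ℝ²` (with `Q_x`, `Q_xx` the entrywise derivatives). -/
def Vfield (u v w : ℝ × ℝ → ℂ) (ζ : ℂ) (p : ℝ × ℝ) : Matrix (Fin 4) (Fin 4) ℂ :=
  Vmat ζ (u p) (v p) (w p) (dX u p) (dX v p) (dX w p)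
    (dX (dX u) p) (dX (dX v) p) (dX (dX w) p)

/-- Entrywise `x`-derivative of a matrix-valued field. -/
def dXM (F : ℝ × ℝ → Matrix (Fin 4) (Fin 4) ℂ) (p : ℝ × ℝ) : Matrix (Fin 4) (Fin 4) ℂ :=
  Matrix.of fun i j => deriv (fun x => F (x, p.2) i j) p.1

/-- Entrywise `t`-derivative of a matrix-valued field. -/
def dTM (F : ℝ × ℝ → Matrix (Fin 4) (Fin 4) ℂ) (p : ℝ × ℝ) : Matrix (Fin 4) (Fin 4) ℂ :=
  Matrix.of fun i j => deriv (fun t => F (p.1, t) i j) p.2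

/-- `Ψ` solves the Lax pair `Ψ_x = U(ζ)Ψ`, `Ψ_t = V(ζ)Ψ` with potentials `(u,v,w)`. -/
def SolvesLax (u v w : ℝ × ℝ → ℂ) (ζ : ℂ) (Ψ : ℝ × ℝ → Fin 4 → ℂ) : Prop :=
  ∀ p : ℝ × ℝ,
    HasDerivAt (fun x => Ψ (x, p.2)) ((Ufield u v w ζ p).mulVec (Ψ p)) p.1 ∧
    HasDerivAt (fun t => Ψ (p.1, t)) ((Vfield u v w ζ p).mulVec (Ψ p)) p.2

/-- The rank-one projection `ψψ†/(ψ†ψ)`. -/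
def projOf (ψ : Fin 4 → ℂ) : Matrix (Fin 4) (Fin 4) ℂ :=
  (star ψ ⬝ᵥ ψ)⁻¹ • vecMulVec ψ (star ψ)

/-- One-fold Darboux matrix `T(ζ) = I - ((ζ₁ - ζ₁*)/(ζ - ζ₁*)) ψψ†/(ψ†ψ)`. -/
def Tone (ζ₁ ζ : ℂ) (ψ : Fin 4 → ℂ) : Matrix (Fin 4) (Fin 4) ℂ :=
  1 - ((ζ₁ - (starRingEnd ℂ) ζ₁) / (ζ - (starRingEnd ℂ) ζ₁)) • projOf ψ

/-- Transformed potential `f - 2i(ζ₁ - ζ₁*) Ψ₁⁰ (Ψ₁ʲ)* / (Ψ₁†Ψ₁)` of the one-fold DT. -/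
def u1of (f : ℝ × ℝ → ℂ) (ζ₁ : ℂ) (Ψ₁ : ℝ × ℝ → Fin 4 → ℂ) (j : Fin 4) : ℝ × ℝ → ℂ :=
  fun p => f p - 2 * Complex.I * (ζ₁ - (starRingEnd ℂ) ζ₁) * Ψ₁ p 0
      * (starRingEnd ℂ) (Ψ₁ p j) / (star (Ψ₁ p) ⬝ᵥ Ψ₁ p)

/-- The iterated eigenfunctions `Ψ_i^{(k)}` of the `N`-fold Darboux recursion
(0-based indexing: `PsiIter ζs Ψs k i = Ψ_{i+1}^{(k)}`). -/
def PsiIter (ζs : ℕ → ℂ) (Ψs : ℕ → ℝ × ℝ → Fin 4 → ℂ) : ℕ → ℕ → ℝ × ℝ → Fin 4 → ℂ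
  | 0, i => Ψs i
  | k + 1, i => fun p =>
      (Tone (ζs k) (ζs i) (PsiIter ζs Ψs k k p)).mulVec (PsiIter ζs Ψs k i p)

/-- The product `T_N(ζ) = T[N](ζ) ⋯ T[1](ζ)` of the `N`-fold Darboux recursion. -/
def TNmat (ζs : ℕ → ℂ) (Ψs : ℕ → ℝ × ℝ → Fin 4 → ℂ) :
    ℕ → ℂ → ℝ × ℝ → Matrix (Fin 4) (Fin 4) ℂ
  | 0, _, _ => 1
  | k + 1, ζ, p => Tone (ζs k) ζ (PsiIter ζs Ψs k k p) * TNmat ζs Ψs k ζ p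

/-- The explicit eigenfunction of the Lax pair for the zero seed at eigenvalue `ζk`. -/
def seedPsi (ζk : ℂ) (c₁ c₂ c₃ : ℝ) (p : ℝ × ℝ) : Fin 4 → ℂ :=
  ![Complex.exp (-Complex.I * ζk * (4 * p.2 * ζk ^ 2 + p.1)),
    c₁ * Complex.exp (Complex.I * ζk * (4 * p.2 * ζk ^ 2 + p.1)),
    c₂ * Complex.exp (Complex.I * ζk * (4 * p.2 * ζk ^ 2 + p.1)),
    c₃ * Complex.exp (Complex.I * ζk * (4 * p.2 * ζk ^ 2 + p.1))]

/-- The `N×N` matrix `M` with entries `M_{jk} = Ψ_j†Ψ_k/(ζ_k - ζ_j*)`. -/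
def MmatOf {N : ℕ} (ζs : Fin N → ℂ) (Ψs : Fin N → ℝ × ℝ → Fin 4 → ℂ) (p : ℝ × ℝ) :
    Matrix (Fin N) (Fin N) ℂ :=
  Matrix.of fun j k => (star (Ψs j p) ⬝ᵥ Ψs k p) / (ζs k - (starRingEnd ℂ) (ζs j))

/-- The `4×N` matrix `X = (Ψ₁, …, Ψ_N)` whose columns are the eigenfunctions. -/
def XmatOf {N : ℕ} (Ψs : Fin N → ℝ × ℝ → Fin 4 → ℂ) (p : ℝ × ℝ) :
    Matrix (Fin 4) (Fin N) ℂ :=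
  Matrix.of fun a j => Ψs j p a

/-- `M` bordered on the right by the column `c` and at the bottom by the row `(r, 0)`. -/
def bordered {N : ℕ} (M : Matrix (Fin N) (Fin N) ℂ) (c r : Fin N → ℂ) :
    Matrix (Fin (N + 1)) (Fin (N + 1)) ℂ :=
  Matrix.of fun i j =>
    Fin.lastCases
      (Fin.lastCases (0 : ℂ) (fun j' => r j') j)
      (fun i' => Fin.lastCases (c i') (fun j' => M i' j') j)
      i

/-- The cubic matrix pencil `z³V₃ + z²V₂ + zV₁ + V₀`. -/
def cubicPencil {A : Type*} [Ring A] [Algebra ℂ A] (V₀ V₁ V₂ V₃ : A) (z : ℂ) : A :=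
  z ^ 3 • V₃ + z ^ 2 • V₂ + z • V₁ + V₀

section Algebraic

variable {A : Type*} [Ring A]

theorem darboux_linear_coeff {K Q Qx S Q' Sx Qx' : A} (hK : K * K = -1)
    (hQ : Q * K = -(K * Q)) (hQx : Qx * K = -(K * Qx))
    (hQ' : Q' = Q + (K * S - S * K)) (hSx : Sx = Q' * S - S * Q)
    (hQx' : Qx' = Qx + (K * Sx - Sx * K)) :
    2 * ((Q' ^ 2 + Qx') * K) = 2 * ((Q ^ 2 + Qx) * K) - S * (4 * Q) + 4 * Q' * S := by
  have hK' (a : A) : K * (K * a) = -a := by rw [← mul_assoc, hK, neg_one_mul]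
  have hQ2 (a : A) : Q * (K * a) = -(K * (Q * a)) := by simp only [← mul_assoc, hQ, neg_mul]
  have h4 : (4 : A) = 1 + 1 + 1 + 1 := by norm_num
  subst hQx' hSx hQ'
  simp only [h4, two_mul, pow_two, mul_add, add_mul, mul_sub, sub_mul, mul_assoc, hK, hQ, hQx,
    hK', hQ2, mul_neg, neg_mul, neg_neg, mul_one, one_mul]
  abel

theorem darboux_constant_coeff {K Q Qx Qxx S Q' Sx Qx' Sxx Qxx' : A} (hK : K * K = -1)
    (hQ : Q * K = -(K * Q)) (hQx : Qx * K = -(K * Qx))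
    (hQ' : Q' = Q + (K * S - S * K)) (hSx : Sx = Q' * S - S * Q)
    (hQx' : Qx' = Qx + (K * Sx - Sx * K))
    (hSxx : Sxx = Qx' * S + Q' * Sx - (Sx * Q + S * Qx))
    (hQxx' : Qxx' = Qxx + (K * Sxx - Sxx * K)) :
    -Qxx' + 2 * Q' ^ 3 + Qx' * Q' - Q' * Qx' =
      (-Qxx + 2 * Q ^ 3 + Qx * Q - Q * Qx) - S * (2 * ((Q ^ 2 + Qx) * K))
        + 2 * ((Q' ^ 2 + Qx') * K) * S := by
  have hK' (a : A) : K * (K * a) = -a := by rw [← mul_assoc, hK, neg_one_mul]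
  have hQ2 (a : A) : Q * (K * a) = -(K * (Q * a)) := by simp only [← mul_assoc, hQ, neg_mul]
  have hQx2 (a : A) : Qx * (K * a) = -(K * (Qx * a)) := by simp only [← mul_assoc, hQx, neg_mul]
  subst hQxx' hSxx hQx' hSx hQ'
  simp only [two_mul, pow_succ, pow_zero, mul_add, add_mul, mul_sub, sub_mul, mul_assoc, hK, hQ,
    hQx, hK', hQ2, hQx2, mul_neg, neg_mul, neg_neg, mul_one, one_mul]
  abel

variable [Algebra ℂ A]

theorem cubicPencil_intertwining {V₀ V₁ V₂ V₃ S V₂' V₁' V₀' : A}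
    (h₂ : V₂' = V₂ - S * V₃ + V₃ * S) (h₁ : V₁' = V₁ - S * V₂ + V₂' * S)
    (h₀ : V₀' = V₀ - S * V₁ + V₁' * S) (z : ℂ) :
    -((V₀ + V₁ * S + V₂ * S ^ 2 + V₃ * S ^ 3) * S - S * (V₀ + V₁ * S + V₂ * S ^ 2 + V₃ * S ^ 3))
        + (z • 1 - S) * cubicPencil V₀ V₁ V₂ V₃ z
      = cubicPencil V₀' V₁' V₂' V₃ z * (z • 1 - S) := by
  subst h₀ h₁ h₂
  simp only [cubicPencil, pow_succ, pow_zero, mul_add, add_mul, mul_sub, sub_mul, mul_assoc,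
    one_mul, mul_one, smul_mul_assoc, mul_smul_comm, smul_add, smul_sub]
  module

theorem projection_flow_eq_commutator {V₀ V₁ V₂ V₃ P S : A} {a b : ℂ} (hP : P * P = P)
    (hS : S = b • 1 + (a - b) • P) :
    (a - b) • ((1 - P) * cubicPencil V₀ V₁ V₂ V₃ a * P
        - P * cubicPencil V₀ V₁ V₂ V₃ b * (1 - P))
      = (V₀ + V₁ * S + V₂ * S ^ 2 + V₃ * S ^ 3) * S
        - S * (V₀ + V₁ * S + V₂ * S ^ 2 + V₃ * S ^ 3) := by
  have hSP : S * P = a • P := by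
    rw [hS, add_mul, smul_mul_assoc, smul_mul_assoc, hP, one_mul]; module
  have hSR : S * (1 - P) = b • (1 - P) := by
    rw [hS, add_mul, smul_mul_assoc, smul_mul_assoc, mul_sub P, hP, one_mul, mul_one]; module
  have ha : cubicPencil V₀ V₁ V₂ V₃ a * P = (V₀ + V₁ * S + V₂ * S ^ 2 + V₃ * S ^ 3) * P := by
    simp only [cubicPencil, pow_succ, pow_zero, one_mul, add_mul, mul_assoc, hSP, mul_smul_comm,
      smul_mul_assoc]
    module
  have hb : cubicPencil V₀ V₁ V₂ V₃ b * (1 - P)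
      = (V₀ + V₁ * S + V₂ * S ^ 2 + V₃ * S ^ 3) * (1 - P) := by
    simp only [cubicPencil, pow_succ, pow_zero, one_mul, add_mul, mul_assoc, hSR, mul_smul_comm,
      smul_mul_assoc]
    module
  rw [mul_assoc, mul_assoc, ha, hb]
  generalize V₀ + V₁ * S + V₂ * S ^ 2 + V₃ * S ^ 3 = W
  subst hS
  simp only [mul_add, add_mul, mul_sub, sub_mul, one_mul, mul_one, smul_mul_assoc, mul_smul_comm]
  module

end Algebraic

/-- The skew-adjoint matrix `-iJ`. -/
def Kmat : Matrix (Fin 4) (Fin 4) ℂ := -Complex.I • Jmat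

section MatrixCalculus

attribute [local instance] Matrix.linftyOpNormedRing Matrix.linftyOpNormedAlgebra

theorem hasDerivAt_matrix_iff {F : ℝ → Matrix (Fin 4) (Fin 4) ℂ} {F' : Matrix (Fin 4) (Fin 4) ℂ}
    {x : ℝ} : HasDerivAt F F' x ↔ ∀ i j, HasDerivAt (fun y => F y i j) (F' i j) x :=
  hasDerivAt_pi.trans (forall_congr' fun _ => hasDerivAt_pi)

theorem HasDerivAt.qmat {f g h : ℝ → ℂ} {f' g' h' : ℂ} {x : ℝ} (hf : HasDerivAt f f' x)
    (hg : HasDerivAt g g' x) (hh : HasDerivAt h h' x) :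
    HasDerivAt (fun y => Qmat (f y) (g y) (h y)) (Qmat f' g' h') x := by
  rw [hasDerivAt_matrix_iff]
  intro i j
  fin_cases i <;> fin_cases j <;>
    first
    | exact hasDerivAt_const x (0 : ℂ)
    | assumption
    | exact hf.star.fun_neg
    | exact hg.star.fun_neg
    | exact hh.star.fun_neg

theorem qmat_dX_eq {f g h : ℝ × ℝ → ℂ} {p : ℝ × ℝ} {M : Matrix (Fin 4) (Fin 4) ℂ}
    (H : HasDerivAt (fun x => Qmat (f (x, p.2)) (g (x, p.2)) (h (x, p.2))) M p.1) :
    Qmat (dX f p) (dX g p) (dX h p) = M := by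
  have e := hasDerivAt_matrix_iff.1 H
  have hf : HasDerivAt (fun x => f (x, p.2)) (M 0 1) p.1 := e 0 1
  have hg : HasDerivAt (fun x => g (x, p.2)) (M 0 2) p.1 := e 0 2
  have hh : HasDerivAt (fun x => h (x, p.2)) (M 0 3) p.1 := e 0 3
  have := (hf.qmat hg hh).unique H
  rwa [← hf.deriv, ← hg.deriv, ← hh.deriv] at this

open scoped ComplexOrder in
theorem star_dotProduct_self_ne_zero {ψ : Fin 4 → ℂ} (h : ψ ≠ 0) : star ψ ⬝ᵥ ψ ≠ 0 :=
  fun e => h (dotProduct_star_self_eq_zero.1 e)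

theorem projOf_mul_self {ψ : Fin 4 → ℂ} (h : ψ ≠ 0) : projOf ψ * projOf ψ = projOf ψ := by
  have := star_dotProduct_self_ne_zero h
  rw [projOf, smul_mul_smul_comm, vecMulVec_mul_vecMulVec, vecMulVec_smul, smul_smul]
  congr 1
  field_simp

theorem projOf_mul_mul_projOf {ψ : Fin 4 → ℂ} (M : Matrix (Fin 4) (Fin 4) ℂ) :
    projOf ψ * M * projOf ψ = ((star ψ ⬝ᵥ ψ)⁻¹ * (star ψ ⬝ᵥ M *ᵥ ψ)) • projOf ψ := by
  rw [projOf, mul_assoc, mul_smul_comm, smul_mul_smul_comm, mul_vecMulVec, vecMulVec_mul_vecMulVec,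
    vecMulVec_smul, smul_smul, smul_smul]
  congr 1
  ring

theorem hasDerivAt_projOf {ψ : ℝ → Fin 4 → ℂ} {x : ℝ} {M N : Matrix (Fin 4) (Fin 4) ℂ}
    (hψ : HasDerivAt ψ (M *ᵥ ψ x) x) (h0 : ψ x ≠ 0) (hMN : Mᴴ = -N) :
    HasDerivAt (fun y => projOf (ψ y))
      ((1 - projOf (ψ x)) * M * projOf (ψ x) - projOf (ψ x) * N * (1 - projOf (ψ x))) x := by
  have hn := star_dotProduct_self_ne_zero h0
  have hstar : star (M *ᵥ ψ x) = -(star (ψ x) ᵥ* N) := by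
    rw [star_mulVec, hMN, vecMul_neg]
  have hc := hasDerivAt_pi.1 hψ
  have hR : HasDerivAt (fun y => vecMulVec (ψ y) (star (ψ y)))
      (vecMulVec (M *ᵥ ψ x) (star (ψ x)) + vecMulVec (ψ x) (star (M *ᵥ ψ x))) x :=
    hasDerivAt_matrix_iff.2 fun i j => (hc i).fun_mul (hc j).star
  have hd : HasDerivAt (fun y => star (ψ y) ⬝ᵥ ψ y)
      (star (M *ᵥ ψ x) ⬝ᵥ ψ x + star (ψ x) ⬝ᵥ M *ᵥ ψ x) x := by
    have := HasDerivAt.fun_sum (u := Finset.univ) fun i _ => (hc i).star.fun_mul (hc i)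
    rw [Finset.sum_add_distrib] at this
    exact this
  have hP := (hd.fun_inv hn).fun_smul hR
  refine hP.congr_deriv ?_
  have hM := projOf_mul_mul_projOf (ψ := ψ x) M
  have hN := projOf_mul_mul_projOf (ψ := ψ x) N
  simp only [mul_sub, sub_mul, one_mul, mul_one]
  rw [hM, hN, hstar, ← mul_vecMulVec, vecMulVec_neg, ← vecMulVec_mul, neg_dotProduct,
    ← dotProduct_mulVec]
  simp only [projOf, mul_smul_comm, smul_mul_assoc, smul_smul]
  match_scalars <;> field_simp
  ring

theorem qmat_mul_K (a b c : ℂ) : Qmat a b c * Kmat = -(Kmat * Qmat a b c) := by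
  ext i j
  fin_cases i <;> fin_cases j <;>
    simp [Kmat, Jmat, Qmat, Matrix.mul_apply, Matrix.diagonal] <;> ring

theorem K_mul_K : Kmat * Kmat = -1 := by
  ext i j
  fin_cases i <;> fin_cases j <;>
    simp [Kmat, Jmat, Matrix.mul_apply, Matrix.diagonal]

theorem star_K : star Kmat = -Kmat := by
  ext i j
  fin_cases i <;> fin_cases j <;> simp [Kmat, Jmat, Matrix.star_apply, Matrix.diagonal]

theorem star_qmat (a b c : ℂ) : star (Qmat a b c) = -Qmat a b c := by
  ext i j
  fin_cases i <;> fin_cases j <;> simp [Qmat, Matrix.star_apply]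

theorem umat_eq_cubicPencil (ζ u v w : ℂ) :
    Umat ζ u v w = cubicPencil (Qmat u v w) Kmat 0 0 ζ := by
  simp only [Umat, cubicPencil, Kmat]
  module

theorem vmat_eq_cubicPencil (ζ u v w ux vx wx uxx vxx wxx : ℂ) :
    Vmat ζ u v w ux vx wx uxx vxx wxx
      = cubicPencil (-Qmat uxx vxx wxx + 2 * Qmat u v w ^ 3
          + Qmat ux vx wx * Qmat u v w - Qmat u v w * Qmat ux vx wx)
        (2 * ((Qmat u v w ^ 2 + Qmat ux vx wx) * Kmat)) (4 * Qmat u v w) (4 * Kmat) ζ := by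
  have h4 : (4 : Matrix (Fin 4) (Fin 4) ℂ) = 1 + 1 + 1 + 1 := by norm_num
  simp only [Vmat, cubicPencil, Kmat, h4, two_mul, add_mul, one_mul, mul_smul_comm]
  module

theorem star_cubicPencil {V₀ V₁ V₂ V₃ : Matrix (Fin 4) (Fin 4) ℂ} (h₀ : star V₀ = -V₀)
    (h₁ : star V₁ = -V₁) (h₂ : star V₂ = -V₂) (h₃ : star V₃ = -V₃) (z : ℂ) :
    (cubicPencil V₀ V₁ V₂ V₃ z)ᴴ = -cubicPencil V₀ V₁ V₂ V₃ ((starRingEnd ℂ) z) := by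
  rw [← star_eq_conjTranspose]
  simp only [cubicPencil, star_add, star_smul, h₀, h₁, h₂, h₃, star_pow, starRingEnd_apply]
  module

/-- The spectral matrix `S = ζ₁* + (ζ₁ - ζ₁*) ψψ†/(ψ†ψ)`. -/
def spectralMat (ζ₁ : ℂ) (ψ : Fin 4 → ℂ) : Matrix (Fin 4) (Fin 4) ℂ :=
  (starRingEnd ℂ) ζ₁ • 1 + (ζ₁ - (starRingEnd ℂ) ζ₁) • projOf ψ

theorem tone_eq_smul_sub_spectralMat {ζ₁ ζ : ℂ} (hζ : ζ ≠ (starRingEnd ℂ) ζ₁) (ψ : Fin 4 → ℂ) :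
    Tone ζ₁ ζ ψ = (ζ - (starRingEnd ℂ) ζ₁)⁻¹ • (ζ • 1 - spectralMat ζ₁ ψ) := by
  have := sub_ne_zero.2 hζ
  rw [Tone, spectralMat]
  match_scalars <;> field_simp

theorem hasDerivAt_spectralMat {ψ : ℝ → Fin 4 → ℂ} {x : ℝ} {ζ₁ : ℂ}
    {V₀ V₁ V₂ V₃ S : Matrix (Fin 4) (Fin 4) ℂ}
    (hψ : HasDerivAt ψ (cubicPencil V₀ V₁ V₂ V₃ ζ₁ *ᵥ ψ x) x) (hnz : ψ x ≠ 0)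
    (h₀ : star V₀ = -V₀) (h₁ : star V₁ = -V₁) (h₂ : star V₂ = -V₂) (h₃ : star V₃ = -V₃)
    (hS : S = spectralMat ζ₁ (ψ x)) :
    HasDerivAt (fun y => spectralMat ζ₁ (ψ y))
      ((V₀ + V₁ * S + V₂ * S ^ 2 + V₃ * S ^ 3) * S
        - S * (V₀ + V₁ * S + V₂ * S ^ 2 + V₃ * S ^ 3)) x := by
  rw [← projection_flow_eq_commutator (projOf_mul_self hnz) hS]
  exact ((hasDerivAt_projOf hψ hnz (star_cubicPencil h₀ h₁ h₂ h₃ ζ₁)).fun_const_smul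
    (ζ₁ - (starRingEnd ℂ) ζ₁)).const_add _

theorem hasDerivAt_tone {ψ : ℝ → Fin 4 → ℂ} {x : ℝ} {ζ₁ ζ : ℂ}
    (hζ : ζ ≠ (starRingEnd ℂ) ζ₁) {S' : Matrix (Fin 4) (Fin 4) ℂ}
    (h : HasDerivAt (fun y => spectralMat ζ₁ (ψ y)) S' x) :
    HasDerivAt (fun y => Tone ζ₁ ζ (ψ y)) ((ζ - (starRingEnd ℂ) ζ₁)⁻¹ • -S') x := by
  simp only [tone_eq_smul_sub_spectralMat hζ]
  exact (h.const_sub _).fun_const_smul _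

/-- The intertwining relation along a line, for skew-adjoint pencil coefficients related by the
Darboux recursion. -/
theorem tone_intertwining {ψ : ℝ → Fin 4 → ℂ} {x : ℝ} {ζ₁ ζ : ℂ}
    {V₀ V₁ V₂ V₃ S V₂' V₁' V₀' : Matrix (Fin 4) (Fin 4) ℂ} (hζ : ζ ≠ (starRingEnd ℂ) ζ₁)
    (hψ : HasDerivAt ψ (cubicPencil V₀ V₁ V₂ V₃ ζ₁ *ᵥ ψ x) x) (hnz : ψ x ≠ 0)
    (h₀ : star V₀ = -V₀) (h₁ : star V₁ = -V₁) (h₂ : star V₂ = -V₂) (h₃ : star V₃ = -V₃)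
    (hS : S = spectralMat ζ₁ (ψ x))
    (h₂' : V₂' = V₂ - S * V₃ + V₃ * S) (h₁' : V₁' = V₁ - S * V₂ + V₂' * S)
    (h₀' : V₀' = V₀ - S * V₁ + V₁' * S) :
    (Matrix.of fun i j => deriv (fun y => Tone ζ₁ ζ (ψ y) i j) x)
        + Tone ζ₁ ζ (ψ x) * cubicPencil V₀ V₁ V₂ V₃ ζ
      = cubicPencil V₀' V₁' V₂' V₃ ζ * Tone ζ₁ ζ (ψ x) := by
  have hT := hasDerivAt_tone hζ (hasDerivAt_spectralMat hψ hnz h₀ h₁ h₂ h₃ hS)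
  have hd : (Matrix.of fun i j => deriv (fun y => Tone ζ₁ ζ (ψ y) i j) x) = _ :=
    Matrix.ext fun i j => (hasDerivAt_matrix_iff.1 hT i j).deriv
  rw [hd, tone_eq_smul_sub_spectralMat hζ, ← hS, smul_mul_assoc, mul_smul_comm, ← smul_add,
    cubicPencil_intertwining h₂' h₁' h₀']

theorem qmat_u1of (u v w : ℝ × ℝ → ℂ) (ζ₁ : ℂ) (Ψ : ℝ × ℝ → Fin 4 → ℂ) (p : ℝ × ℝ) :
    Qmat (u1of u ζ₁ Ψ 1 p) (u1of v ζ₁ Ψ 2 p) (u1of w ζ₁ Ψ 3 p)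
      = Qmat (u p) (v p) (w p)
        + (Kmat * spectralMat ζ₁ (Ψ p) - spectralMat ζ₁ (Ψ p) * Kmat) := by
  have hn : (starRingEnd ℂ) (star (Ψ p) ⬝ᵥ Ψ p) = star (Ψ p) ⬝ᵥ Ψ p := by
    simp [dotProduct, Fin.sum_univ_four, mul_comm]
  ext i j
  fin_cases i <;> fin_cases j <;>
    simp [Kmat, Jmat, Qmat, u1of, spectralMat, projOf, Matrix.mul_apply,
      Matrix.diagonal, vecMulVec_apply, hn, map_ofNat, Matrix.one_apply,
      div_eq_mul_inv, -mul_eq_mul_left_iff, -mul_eq_mul_right_iff] <;> ring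

theorem hasDerivAt_dX {f : ℝ × ℝ → ℂ} (hf : ContDiff ℝ (⊤ : ℕ∞) f) (p : ℝ × ℝ) :
    HasDerivAt (fun x => f (x, p.2)) (dX f p) p.1 ∧
      HasDerivAt (fun x => dX f (x, p.2)) (dX (dX f) p) p.1 := by
  have h : ContDiff ℝ 2 fun x : ℝ => f (x, p.2) :=
    (contDiff_infty.1 hf 2).comp (contDiff_id.prodMk contDiff_const)
  exact ⟨(h.differentiable (by norm_num) p.1).hasDerivAt,
    (h.differentiable_deriv_two p.1).hasDerivAt⟩

theorem hasDerivAt_qmat_add_commutator {f g h : ℝ × ℝ → ℂ}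
    {F S : ℝ × ℝ → Matrix (Fin 4) (Fin 4) ℂ} {F' S' : Matrix (Fin 4) (Fin 4) ℂ} {p : ℝ × ℝ}
    (hF : ∀ q, Qmat (f q) (g q) (h q) = F q + (Kmat * S q - S q * Kmat))
    (dF : HasDerivAt (fun x => F (x, p.2)) F' p.1) (dS : HasDerivAt (fun x => S (x, p.2)) S' p.1) :
    HasDerivAt (fun x => Qmat (f (x, p.2)) (g (x, p.2)) (h (x, p.2)))
        (Qmat (dX f p) (dX g p) (dX h p)) p.1 ∧
      Qmat (dX f p) (dX g p) (dX h p) = F' + (Kmat * S' - S' * Kmat) := by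
  have d : HasDerivAt (fun x => Qmat (f (x, p.2)) (g (x, p.2)) (h (x, p.2)))
      (F' + (Kmat * S' - S' * Kmat)) p.1 := by
    simp only [hF]
    exact dF.fun_add ((dS.const_mul Kmat).fun_sub (dS.mul_const Kmat))
  exact ⟨d.congr_deriv (qmat_dX_eq d).symm, qmat_dX_eq d⟩

/-- Derivatives of the transformed potential matrix `Q + [K, S]` in terms of those of `Q`. -/
theorem qmat_derivatives_of_darboux {u v w u' v' w' : ℝ × ℝ → ℂ}
    (hu : ContDiff ℝ (⊤ : ℕ∞) u) (hv : ContDiff ℝ (⊤ : ℕ∞) v) (hw : ContDiff ℝ (⊤ : ℕ∞) w)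
    {ζ₁ : ℂ} {Ψ : ℝ × ℝ → Fin 4 → ℂ} (hnz : ∀ q, Ψ q ≠ 0)
    (hlax : ∀ q : ℝ × ℝ, HasDerivAt (fun x => Ψ (x, q.2))
      (cubicPencil (Qmat (u q) (v q) (w q)) Kmat 0 0 ζ₁ *ᵥ Ψ q) q.1)
    (hQ' : ∀ q, Qmat (u' q) (v' q) (w' q) = Qmat (u q) (v q) (w q)
      + (Kmat * spectralMat ζ₁ (Ψ q) - spectralMat ζ₁ (Ψ q) * Kmat)) (p : ℝ × ℝ) :
    ∃ Sx Sxx : Matrix (Fin 4) (Fin 4) ℂ,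
      Sx = Qmat (u' p) (v' p) (w' p) * spectralMat ζ₁ (Ψ p)
        - spectralMat ζ₁ (Ψ p) * Qmat (u p) (v p) (w p) ∧
      Qmat (dX u' p) (dX v' p) (dX w' p)
        = Qmat (dX u p) (dX v p) (dX w p) + (Kmat * Sx - Sx * Kmat) ∧
      Sxx = Qmat (dX u' p) (dX v' p) (dX w' p) * spectralMat ζ₁ (Ψ p)
          + Qmat (u' p) (v' p) (w' p) * Sx
          - (Sx * Qmat (u p) (v p) (w p)
            + spectralMat ζ₁ (Ψ p) * Qmat (dX u p) (dX v p) (dX w p)) ∧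
      Qmat (dX (dX u') p) (dX (dX v') p) (dX (dX w') p)
        = Qmat (dX (dX u) p) (dX (dX v) p) (dX (dX w) p) + (Kmat * Sxx - Sxx * Kmat) := by
  obtain ⟨S, hS⟩ : ∃ S : ℝ × ℝ → Matrix (Fin 4) (Fin 4) ℂ, ∀ q, spectralMat ζ₁ (Ψ q) = S q :=
    ⟨_, fun _ => rfl⟩
  simp only [hS] at hQ' ⊢
  have dQ (q : ℝ × ℝ) := (hasDerivAt_dX hu q).1.qmat (hasDerivAt_dX hv q).1 (hasDerivAt_dX hw q).1
  have dQx := (hasDerivAt_dX hu p).2.qmat (hasDerivAt_dX hv p).2 (hasDerivAt_dX hw p).2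
  obtain ⟨Sx, hSx⟩ : ∃ Sx : ℝ × ℝ → Matrix (Fin 4) (Fin 4) ℂ, ∀ q,
      Sx q = Qmat (u' q) (v' q) (w' q) * S q - S q * Qmat (u q) (v q) (w q) :=
    ⟨_, fun _ => rfl⟩
  have dS (q : ℝ × ℝ) : HasDerivAt (fun x => S (x, q.2)) (Sx q) q.1 := by
    simp only [← hS (_, q.2)]
    refine (hasDerivAt_spectralMat (hlax q) (hnz q) (star_qmat ..) star_K
      (by simp) (by simp) (hS q).symm).congr_deriv ?_
    rw [hSx, hQ']
    noncomm_ring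
  have hd (q : ℝ × ℝ) := hasDerivAt_qmat_add_commutator hQ' (dQ q) (dS q)
  have dSx : HasDerivAt (fun x => Sx (x, p.2))
      (Qmat (dX u' p) (dX v' p) (dX w' p) * S p + Qmat (u' p) (v' p) (w' p) * Sx p
        - (Sx p * Qmat (u p) (v p) (w p) + S p * Qmat (dX u p) (dX v p) (dX w p))) p.1 := by
    rw [funext fun x : ℝ => hSx (x, p.2)]
    exact ((hd p).1.fun_mul (dS p)).fun_sub ((dS p).fun_mul (dQ p))
  exact ⟨Sx p, _, hSx p, (hd p).2, rfl,
    (hasDerivAt_qmat_add_commutator (fun q => (hd q).2) dQx dSx).2⟩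

end MatrixCalculus

/-- the intertwining identities
`∂_x T[1](ζ) + T[1](ζ)U(ζ) = U[1](ζ)T[1](ζ)` and
`∂_t T[1](ζ) + T[1](ζ)V(ζ) = V[1](ζ)T[1](ζ)` for the one-fold Darboux matrix. -/
theorem one_fold_darboux_intertwining (u v w : ℝ × ℝ → ℂ)
    (hu : ContDiff ℝ (⊤ : ℕ∞) u) (hv : ContDiff ℝ (⊤ : ℕ∞) v)
    (hw : ContDiff ℝ (⊤ : ℕ∞) w) (hsol : vcmKdVeq u v w)
    (ζ₁ : ℂ) (hζ : ζ₁ ≠ (starRingEnd ℂ) ζ₁)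
    (Ψ₁ : ℝ × ℝ → Fin 4 → ℂ) (hnz : ∀ p : ℝ × ℝ, Ψ₁ p ≠ 0)
    (hlax : SolvesLax u v w ζ₁ Ψ₁) :
    ∀ ζ : ℂ, ζ ≠ (starRingEnd ℂ) ζ₁ → ∀ p : ℝ × ℝ,
      dXM (fun q => Tone ζ₁ ζ (Ψ₁ q)) p + Tone ζ₁ ζ (Ψ₁ p) * Ufield u v w ζ p
        = Ufield (u1of u ζ₁ Ψ₁ 1) (u1of v ζ₁ Ψ₁ 2) (u1of w ζ₁ Ψ₁ 3) ζ p
            * Tone ζ₁ ζ (Ψ₁ p) ∧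
      dTM (fun q => Tone ζ₁ ζ (Ψ₁ q)) p + Tone ζ₁ ζ (Ψ₁ p) * Vfield u v w ζ p
        = Vfield (u1of u ζ₁ Ψ₁ 1) (u1of v ζ₁ Ψ₁ 2) (u1of w ζ₁ Ψ₁ 3) ζ p
            * Tone ζ₁ ζ (Ψ₁ p) := by
  intro ζ hζ' p
  have hlaxX (q : ℝ × ℝ) : HasDerivAt (fun x => Ψ₁ (x, q.2))
      (cubicPencil (Qmat (u q) (v q) (w q)) Kmat 0 0 ζ₁ *ᵥ Ψ₁ q) q.1 := by
    rw [← umat_eq_cubicPencil]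
    exact (hlax q).1
  have hlaxT := (hlax p).2
  simp only [Vfield, vmat_eq_cubicPencil] at hlaxT
  simp only [Ufield, Vfield, umat_eq_cubicPencil, vmat_eq_cubicPencil, dXM, dTM]
  have hQ' := qmat_u1of u v w ζ₁ Ψ₁
  generalize u1of u ζ₁ Ψ₁ 1 = u', u1of v ζ₁ Ψ₁ 2 = v', u1of w ζ₁ Ψ₁ 3 = w' at hQ' ⊢
  refine ⟨tone_intertwining (ψ := fun x => Ψ₁ (x, p.2)) hζ' (hlaxX p) (hnz p) (star_qmat ..) star_K
    (by simp) (by simp) rfl (by simp) (by simp) (by rw [hQ']; abel), ?_⟩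
  obtain ⟨Sx, Sxx, hSx, hQx', hSxx, hQxx'⟩ := qmat_derivatives_of_darboux hu hv hw hnz hlaxX hQ' p
  have h4 : (4 : Matrix (Fin 4) (Fin 4) ℂ) = 1 + 1 + 1 + 1 := by norm_num
  refine tone_intertwining (ψ := fun t => Ψ₁ (p.1, t)) hζ' hlaxT (hnz p) ?_ ?_ ?_ ?_ rfl ?_ ?_ ?_
  · simp only [two_mul, star_add, star_sub, star_neg, star_mul, star_pow, star_qmat]
    noncomm_ring
  · have h := qmat_mul_K (u p) (v p) (w p)
    have hx := qmat_mul_K (dX u p) (dX v p) (dX w p)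
    have h' : Qmat (u p) (v p) (w p) * (Kmat * Qmat (u p) (v p) (w p))
        = -(Kmat * (Qmat (u p) (v p) (w p) * Qmat (u p) (v p) (w p))) := by
      rw [← mul_assoc, h, neg_mul, mul_assoc]
    simp only [two_mul, pow_two, star_add, star_mul, star_qmat, star_K]
    simp only [add_mul, mul_add, neg_mul, mul_neg, neg_neg, mul_assoc, h, hx, h']
    abel
  · simp only [h4, add_mul, one_mul, star_add, star_qmat]
    abel
  · simp only [h4, add_mul, one_mul, star_add, star_K]
    abel
  · rw [hQ']
    simp only [h4]
    noncomm_ring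
  · exact darboux_linear_coeff K_mul_K (qmat_mul_K ..) (qmat_mul_K ..) (hQ' p) hSx hQx'
  · exact darboux_constant_coeff K_mul_K (qmat_mul_K ..) (qmat_mul_K ..) (hQ' p) hSx hQx'
      hSxx hQxx'

end
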